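/- Let f : ℝ → ℝ be convex and even with f(0) = 0, f(x) > 0 for all x ≠ 0, and f'(0) = 0, and suppose f is differentiable on an interval (0, δ] for some δ > 0. Suppose there exist q > 1 and c_q > 0 such that f(x)·f'(x)/x^q → c_q as x ↓ 0. Let (x_n) be a strictly decreasing sequence of strictly positive real numbers with x_n → 0 satisfying x_n = x_{n+1} + f(x_{n+1})·f'(x_{n+1}) for every n (with x_{n+1} ∈ (0, δ]). Then n^{1/(q−1)}·x_n → ((q−1)·c_q)^{−1/(q−1)}. -/

import Mathlib

open Filter

/-- If the increments of a real sequence converge to `l`, then `a n / n` converges to `l`. -/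
theorem tendsto_inv_mul_of_tendsto_sub {a : ℕ → ℝ} {l : ℝ}
    (h : Tendsto (fun n => a (n + 1) - a n) atTop (nhds l)) :
    Tendsto (fun n : ℕ => (n : ℝ)⁻¹ * a n) atTop (nhds l) := by
  have h0 : Tendsto (fun n : ℕ => (n : ℝ)⁻¹ * a 0) atTop (nhds 0) := by
    simpa using (tendsto_inv_atTop_nhds_zero_nat (𝕜 := ℝ)).mul_const (a 0)
  have h1 := h.cesaro.add h0
  rw [add_zero] at h1
  refine h1.congr fun n => ?_
  rw [Finset.sum_range_sub]
  ring

/-- The difference quotient of `t ↦ -(1 + t) ^ (-p)` at `0` converges to `p`. -/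
theorem tendsto_one_sub_one_add_rpow_neg_div (p : ℝ) :
    Tendsto (fun h : ℝ => (1 - (1 + h) ^ (-p)) / h) (nhdsWithin 0 {0}ᶜ) (nhds p) := by
  have hd : HasDerivAt (fun t : ℝ => t ^ (-p)) (-p) 1 := by
    simpa using Real.hasDerivAt_rpow_const (x := 1) (p := -p) (Or.inl one_ne_zero)
  have ht := hd.tendsto_slope_zero.neg
  rw [neg_neg] at ht
  refine ht.congr fun h => ?_
  simp only [smul_eq_mul, Real.one_rpow]
  ring

/-- A positive null sequence with `x n = x (n + 1) * (1 + g n * x (n + 1) ^ p)` and `g n → c`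
satisfies `n ^ (1 / p) * x n → (p * c) ^ (-(1 / p))`. -/
theorem tendsto_rpow_mul_of_implicit_recursion {x g : ℕ → ℝ} {p c : ℝ} (hp : 0 < p) (hc : 0 < c)
    (hx_pos : ∀ n, 0 < x n) (hx_lim : Tendsto x atTop (nhds 0))
    (hg : Tendsto g atTop (nhds c))
    (hrec : ∀ n, x n = x (n + 1) * (1 + g n * x (n + 1) ^ p)) :
    Tendsto (fun n : ℕ => (n : ℝ) ^ (1 / p) * x n) atTop (nhds ((p * c) ^ (-(1 / p)))) := by
  have hh : Tendsto (fun n => g n * x (n + 1) ^ p) atTop (nhds 0) := by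
    have h1 : Tendsto (fun n => x (n + 1) ^ p) atTop (nhds 0) := by
      simpa [Real.zero_rpow hp.ne'] using
        ((tendsto_add_atTop_iff_nat 1).2 hx_lim).rpow_const (Or.inr hp.le)
    simpa using hg.mul h1
  have hgpos : ∀ᶠ n in atTop, 0 < g n := hg.eventually_const_lt hc
  have hh' : Tendsto (fun n => g n * x (n + 1) ^ p) atTop (nhdsWithin 0 {0}ᶜ) := by
    refine tendsto_nhdsWithin_iff.2 ⟨hh, ?_⟩
    filter_upwards [hgpos] with n hn
    exact (mul_pos hn (Real.rpow_pos_of_pos (hx_pos _) _)).ne'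
  have hdiff : Tendsto (fun n => x (n + 1) ^ (-p) - x n ^ (-p)) atTop (nhds (p * c)) := by
    refine (((tendsto_one_sub_one_add_rpow_neg_div p).comp hh').mul hg).congr' ?_
    filter_upwards [hgpos] with n hn
    have hy := Real.rpow_pos_of_pos (hx_pos (n + 1)) p
    have hpos : 0 < 1 + g n * x (n + 1) ^ p := by positivity
    have hxn : x n ^ (-p) = x (n + 1) ^ (-p) * (1 + g n * x (n + 1) ^ p) ^ (-p) := by
      rw [← Real.mul_rpow (hx_pos _).le hpos.le, ← hrec]
    rw [hxn, Real.rpow_neg (hx_pos (n + 1)).le, Function.comp_apply]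
    field_simp
  have hpc : p * c ≠ 0 := (mul_pos hp hc).ne'
  refine ((tendsto_inv_mul_of_tendsto_sub (a := fun n => x n ^ (-p)) hdiff).rpow_const
    (p := -(1 / p)) (Or.inl hpc)).congr
    fun n => ?_
  have hn : (0 : ℝ) ≤ (n : ℝ) := n.cast_nonneg
  rw [Real.mul_rpow (inv_nonneg.2 hn) (Real.rpow_nonneg (hx_pos n).le _),
    ← Real.rpow_mul (hx_pos n).le, Real.inv_rpow hn, Real.rpow_neg hn, inv_inv,
    neg_mul_neg, mul_one_div_cancel hp.ne', Real.rpow_one]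

theorem map_exact_rate (f : ℝ → ℝ)
    (hconv : ConvexOn ℝ Set.univ f)
    (heven : ∀ x : ℝ, f (-x) = f x)
    (hf0 : f 0 = 0)
    (hfpos : ∀ x : ℝ, x ≠ 0 → 0 < f x)
    (hderiv0 : HasDerivAt f 0 0)
    (δ : ℝ) (hδ : 0 < δ)
    (hdiff : ∀ t ∈ Set.Ioc (0 : ℝ) δ, DifferentiableAt ℝ f t)
    (q cq : ℝ) (hq : 1 < q) (hcq : 0 < cq)
    (hlim : Tendsto (fun t => f t * deriv f t / t ^ q)
      (nhdsWithin 0 (Set.Ioi 0)) (nhds cq))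
    (x : ℕ → ℝ)
    (hx_anti : StrictAnti x)
    (hx_pos : ∀ n, 0 < x n)
    (hx_lim : Tendsto x atTop (nhds 0))
    (hx_mem : ∀ n, x (n + 1) ∈ Set.Ioc (0 : ℝ) δ)
    (hrec : ∀ n, x n = x (n + 1) + f (x (n + 1)) * deriv f (x (n + 1))) :
    Tendsto (fun n : ℕ => (n : ℝ) ^ (1 / (q - 1)) * x n) atTop
      (nhds (((q - 1) * cq) ^ (-(1 / (q - 1))))) := by
  have hy_lim : Tendsto (fun n => x (n + 1)) atTop (nhdsWithin 0 (Set.Ioi 0)) :=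
    tendsto_nhdsWithin_iff.2
      ⟨(tendsto_add_atTop_iff_nat 1).2 hx_lim, Eventually.of_forall fun n => hx_pos (n + 1)⟩
  refine tendsto_rpow_mul_of_implicit_recursion (sub_pos.2 hq) hcq hx_pos hx_lim
    (hlim.comp hy_lim) fun n => ?_
  have hy := hx_pos (n + 1)
  have hyq := (Real.rpow_pos_of_pos hy q).ne'
  rw [Function.comp_apply, Real.rpow_sub_one hy.ne']
  conv_lhs => rw [hrec n]
  field_simp
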